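/- For every reduced word (i_1,…,i_ν) of w₀ and every H∈𝒰(K_+), there exists a descent chain for H along (i_1,…,i_ν), i.e. a sequence H=H_1,H_2,…,H_{ν+1} in 𝒰(K_+) and a tuple (c_1,…,c_ν)∈K_+^ν as in the definition of descent chain, such that moreover H_{ν+1} = i_1^0 i_2^0 ⋯ i_ν^0. (Equivalently, H = T_{i_1}(c_1)T_{i_2}(c_2)⋯T_{i_ν}(c_ν)𝐇 where 𝐇 = i_1^0⋯i_ν^0.) -/

import Mathlib

open FreeMonoid

/-- The minimum of two elements of an additive subgroup of `ℝ`
(the "sum" in the tropical semifield `K`). -/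
noncomputable def kmin {K : AddSubgroup ℝ} (a b : K) : K :=
  if (a : ℝ) ≤ (b : ℝ) then a else b

/-- Defining relations of the monoid `𝔘(K)` attached to a simply laced Coxeter matrix `M`
and the tropical semifield `K` (a subgroup of `(ℝ, +)` with sum `min` and product `+`). -/
inductive UKRel {I : Type*} (M : CoxeterMatrix I) (K : AddSubgroup ℝ) :
    FreeMonoid (I × K) → FreeMonoid (I × K) → Prop
  | comm (i j : I) (h : M i j = 2) (a b : K) :
      UKRel M K (of (i, a) * of (j, b)) (of (j, b) * of (i, a))
  | braid (i j : I) (h : M i j = 3) (a b c : K) :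
      UKRel M K (of (i, a) * of (j, b) * of (i, c))
        (of (j, b + c - kmin a c) * of (i, kmin a c) * of (j, a + b - kmin a c))
  | idem (i : I) (a b : K) :
      UKRel M K (of (i, a) * of (i, b)) (of (i, kmin a b))

/-- The monoid `𝔘(K)`. -/
noncomputable def UK {I : Type*} (M : CoxeterMatrix I) (K : AddSubgroup ℝ) :=
  (conGen (UKRel M K)).Quotient

noncomputable instance {I : Type*} (M : CoxeterMatrix I) (K : AddSubgroup ℝ) :
    Monoid (UK M K) := Con.monoid _

/-- The generator `i^a` of `𝔘(K)`. -/
noncomputable def genU {I : Type*} (M : CoxeterMatrix I) (K : AddSubgroup ℝ)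
    (i : I) (a : K) : UK M K :=
  (Con.mk' _) (of (i, a))

/-- The product `i₁^{a₁} ⋯ i_n^{a_n}` in `𝔘(K)` associated to a list of pairs. -/
noncomputable def prodU {I : Type*} (M : CoxeterMatrix I) (K : AddSubgroup ℝ)
    (ω : List (I × K)) : UK M K :=
  (ω.map fun p => genU M K p.1 p.2).prod

/-- `l` is a reduced word of `w`. -/
def IsRedWord {I W : Type*} [Group W] {M : CoxeterMatrix I} (cs : CoxeterSystem M W)
    (w : W) (l : List I) : Prop :=
  cs.wordProd l = w ∧ l.length = cs.length w

/-- The set `𝒰(K) = 𝔘_{w₀}(K)` of products over reduced words of `w₀`. -/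
noncomputable def calU {I W : Type*} [Group W] (M : CoxeterMatrix I) (K : AddSubgroup ℝ)
    (cs : CoxeterSystem M W) (w₀ : W) : Set (UK M K) :=
  {u | ∃ ω : List (I × K), IsRedWord cs w₀ (ω.map Prod.fst) ∧ u = prodU M K ω}

/-- The set `𝒰(K₊)`: products over reduced words of `w₀` with coefficients in `K₊ = K ∩ ℝ≥0`. -/
noncomputable def calUplus {I W : Type*} [Group W] (M : CoxeterMatrix I) (K : AddSubgroup ℝ)
    (cs : CoxeterSystem M W) (w₀ : W) : Set (UK M K) :=
  {u | ∃ ω : List (I × K), IsRedWord cs w₀ (ω.map Prod.fst) ∧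
        (∀ p ∈ ω, 0 ≤ (p.2 : ℝ)) ∧ u = prodU M K ω}

/-- Two vertices of the graph on `𝒰(K)` are joined by an edge. -/
noncomputable def UEdge {I W : Type*} [Group W] (M : CoxeterMatrix I) (K : AddSubgroup ℝ)
    (cs : CoxeterSystem M W) (w₀ : W) (H H' : UK M K) : Prop :=
  H ≠ H' ∧ ∃ (i : I) (b b' : K) (ω : List (I × K)),
    IsRedWord cs w₀ (i :: ω.map Prod.fst) ∧
    H = genU M K i b * prodU M K ω ∧ H' = genU M K i b' * prodU M K ω

/-- `H` and `H'` are at distance `≤ k` in the graph on `𝒰(K)`. -/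
noncomputable def DistLE {I W : Type*} [Group W] (M : CoxeterMatrix I) (K : AddSubgroup ℝ)
    (cs : CoxeterSystem M W) (w₀ : W) (k : ℕ) (H H' : UK M K) : Prop :=
  ∃ f : ℕ → UK M K, f 0 = H ∧ f k = H' ∧ (∀ t ≤ k, f t ∈ calU M K cs w₀) ∧
    ∀ t < k, f t = f (t + 1) ∨ UEdge M K cs w₀ (f t) (f (t + 1))

/-- A descent chain for `H ∈ 𝒰(K₊)` along a reduced word `l` of `w₀`: a sequence
`H = Hs 0, Hs 1, …, Hs l.length` in `𝒰(K₊)` together with a tuple `c` in `K₊` such that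
at each step `k`, for some reduced word of `w₀` beginning with `l.get k` and some
coefficients in `K₊`, `Hs k = (l.get k)^{c k} · j₂^{a₂} ⋯ j_ν^{a_ν}` and
`Hs (k+1) = (l.get k)^{0} · j₂^{a₂} ⋯ j_ν^{a_ν}`. -/
noncomputable def DescentChain {I W : Type*} [Group W] (M : CoxeterMatrix I)
    (K : AddSubgroup ℝ) (cs : CoxeterSystem M W) (w₀ : W)
    (l : List I) (H : UK M K) (Hs : ℕ → UK M K) (c : ℕ → K) : Prop :=
  Hs 0 = H ∧
  (∀ k ≤ l.length, Hs k ∈ calUplus M K cs w₀) ∧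
  (∀ k < l.length, 0 ≤ (c k : ℝ)) ∧
  ∀ (k : ℕ) (hk : k < l.length), ∃ ω : List (I × K),
    (∀ p ∈ ω, 0 ≤ (p.2 : ℝ)) ∧
    IsRedWord cs w₀ (l.get ⟨k, hk⟩ :: ω.map Prod.fst) ∧
    Hs k = genU M K (l.get ⟨k, hk⟩) (c k) * prodU M K ω ∧
    Hs (k + 1) = genU M K (l.get ⟨k, hk⟩) 0 * prodU M K ω

namespace CoxeterSystem

variable {I W : Type*} [Group W] {M : CoxeterMatrix I} (cs : CoxeterSystem M W)

section NumbersGame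

open Classical in
/-- The action of the `i`-th generator in the numbers game on integer labellings of the vertices of
a simply laced Coxeter graph. -/
noncomputable def fire (M : CoxeterMatrix I) (i : I) : Function.End (I → ℤ) :=
  fun c j => if j = i then -c i else if M i j = 3 then c j + c i else c j

theorem isLiftable_fire (hM : ∀ i j : I, i ≠ j → M i j = 2 ∨ M i j = 3) :
    M.IsLiftable (fire M) := by
  intro i j
  by_cases hij : i = j
  · subst hij
    rw [M.diagonal, pow_one]
    funext c k
    change fire M i (fire M i c) k = c k
    by_cases hk : k = i <;> by_cases hk' : M i k = 3 <;> simp [fire, hk, hk']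
  · have hji : j ≠ i := fun h => hij h.symm
    have hs := M.symmetric j i
    rcases hM i j hij with h | h
    all_goals rw [h] at hs
    · rw [h, pow_two]
      funext c k
      change fire M i (fire M j (fire M i (fire M j c))) k = c k
      simp only [fire]
      grind
    · rw [h, pow_succ, pow_two]
      funext c k
      change fire M i (fire M j (fire M i (fire M j (fire M i (fire M j c))))) k = c k
      simp only [fire]
      grind

theorem simple_ne_simple (hM : ∀ i j : I, i ≠ j → M i j = 2 ∨ M i j = 3) {i j : I} (hij : i ≠ j) :
    cs.simple i ≠ cs.simple j := by
  classical
  intro h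
  have h' := congrArg (cs.lift ⟨fire M, isLiftable_fire hM⟩) h
  rw [cs.lift_apply_simple, cs.lift_apply_simple] at h'
  have h₁ := congrFun (congrFun h' (Pi.single i 1)) i
  have h₂ : (Pi.single i (1 : ℤ) : I → ℤ) j = 0 := Pi.single_eq_of_ne' hij 1
  simp only [fire, if_true, Pi.single_eq_same, if_neg hij, h₂] at h₁
  split_ifs at h₁
  omega

end NumbersGame

theorem simple_mul_simple_mul_simple {i j : I} (h : M i j = 3) :
    cs.simple i * cs.simple j * cs.simple i = cs.simple j * cs.simple i * cs.simple j := by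
  have hb := cs.wordProd_braidWord_eq i j
  rw [braidWord, braidWord, M.symmetric j i, h] at hb
  simpa [alternatingWord, wordProd, mul_assoc] using hb.symm

section Parity

variable [DecidableEq W]

/-- Conjugation by `s i` on elements of `W`, together with a sign recording whether the element is
`s i` itself. -/
def signedConj (i : I) : Function.End (W × ZMod 2) :=
  fun p => (cs.simple i * p.1 * cs.simple i, p.2 + if p.1 = cs.simple i then 1 else 0)

theorem isLiftable_signedConj (hM : ∀ i j : I, i ≠ j → M i j = 2 ∨ M i j = 3) :
    M.IsLiftable cs.signedConj := by
  have conj_eq (i : I) (a b : W) :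
      cs.simple i * a * cs.simple i = b ↔ a = cs.simple i * b * cs.simple i := by
    constructor <;> rintro rfl <;> simp [mul_assoc]
  have two (x : ZMod 2) : x + x = 0 := CharTwo.add_self_eq_zero x
  intro i j
  by_cases hij : i = j
  · subst hij
    rw [M.diagonal, pow_one]
    funext ⟨t, e⟩
    change cs.signedConj i (cs.signedConj i (t, e)) = (t, e)
    simp only [signedConj, conj_eq]
    simp [mul_assoc, add_assoc, two]
  · have hpow := cs.simple_mul_simple_pow i j
    have hi := cs.simple_mul_simple_self i
    have hj := cs.simple_mul_simple_self j
    have hi' (w : W) := cs.simple_mul_simple_cancel_left (w := w) i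
    have hj' (w : W) := cs.simple_mul_simple_cancel_left (w := w) j
    rcases hM i j hij with h | h
    · have hc : cs.simple i * cs.simple j = cs.simple j * cs.simple i := by
        rw [h, pow_two, mul_eq_one_iff_eq_inv] at hpow
        simpa using hpow
      have hc' (w : W) : cs.simple i * (cs.simple j * w) = cs.simple j * (cs.simple i * w) := by
        rw [← mul_assoc, hc, mul_assoc]
      rw [h, pow_two]
      funext ⟨t, e⟩
      change cs.signedConj i (cs.signedConj j (cs.signedConj i (cs.signedConj j (t, e)))) = (t, e)
      simp only [signedConj, conj_eq]
      simp only [mul_assoc, hc, hc', hi, hj, hi', hj', mul_one, one_mul, Prod.mk.injEq, true_and]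
      linear_combination two (if t = cs.simple i then 1 else 0) +
        two (if t = cs.simple j then 1 else 0)
    · have hc : cs.simple i * (cs.simple j * cs.simple i) =
          cs.simple j * (cs.simple i * cs.simple j) := by
        simpa only [mul_assoc] using cs.simple_mul_simple_mul_simple h
      have hc' (w : W) : cs.simple i * (cs.simple j * (cs.simple i * w)) =
          cs.simple j * (cs.simple i * (cs.simple j * w)) := by
        simpa only [mul_assoc] using congrArg (· * w) hc
      rw [h, pow_succ, pow_two]
      funext ⟨t, e⟩
      change cs.signedConj i (cs.signedConj j (cs.signedConj i (cs.signedConj j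
        (cs.signedConj i (cs.signedConj j (t, e)))))) = (t, e)
      simp only [signedConj, conj_eq]
      simp only [mul_assoc, hc, hc', hi, hj, hi', hj', mul_one, one_mul, Prod.mk.injEq, true_and]
      linear_combination two (if t = cs.simple i then 1 else 0) +
        two (if t = cs.simple j then 1 else 0) +
        two (if t = cs.simple j * (cs.simple i * cs.simple j) then 1 else 0)

theorem lift_signedConj_wordProd (h : M.IsLiftable cs.signedConj) (ω : List I) (t : W) :
    cs.lift ⟨_, h⟩ (cs.wordProd ω) (t, 0) =
      (cs.wordProd ω * t * (cs.wordProd ω)⁻¹, ((cs.rightInvSeq ω).count t : ZMod 2)) := by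
  induction ω with
  | nil => simp [Function.End.one_def]
  | cons i ω ih =>
    rw [wordProd_cons, map_mul]
    change cs.lift ⟨_, h⟩ (cs.simple i) (cs.lift ⟨_, h⟩ (cs.wordProd ω) (t, 0)) = _
    rw [ih, lift_apply_simple, signedConj, rightInvSeq, List.count_cons]
    have : cs.wordProd ω * t * (cs.wordProd ω)⁻¹ = cs.simple i ↔
        (cs.wordProd ω)⁻¹ * cs.simple i * cs.wordProd ω = t := by
      rw [mul_inv_eq_iff_eq_mul, mul_assoc, inv_mul_eq_iff_eq_mul, eq_comm]
    rw [if_congr this rfl rfl]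
    simp only [mul_inv_rev, inv_simple, mul_assoc, beq_iff_eq, Nat.cast_add, Nat.cast_ite,
      Nat.cast_one, Nat.cast_zero]

/-- The parity of the multiplicity of an element in the right inversion sequence of a word only
depends on the product of the word. -/
theorem count_rightInvSeq_of_wordProd_eq
    (hM : ∀ i j : I, i ≠ j → M i j = 2 ∨ M i j = 3)
    {ω ω' : List I} (h : cs.wordProd ω = cs.wordProd ω') (t : W) :
    ((cs.rightInvSeq ω).count t : ZMod 2) = (cs.rightInvSeq ω').count t := by
  have h₁ := cs.lift_signedConj_wordProd (cs.isLiftable_signedConj hM) ω t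
  rw [h, lift_signedConj_wordProd] at h₁
  exact (congrArg Prod.snd h₁).symm

end Parity


/-- The exchange condition, on the right. -/
theorem exists_wordProd_eraseIdx_of_isRightDescent
    (hM : ∀ i j : I, i ≠ j → M i j = 2 ∨ M i j = 3) (ω : List I) {i : I}
    (hi : cs.IsRightDescent (cs.wordProd ω) i) :
    ∃ k < ω.length, cs.wordProd ω * cs.simple i = cs.wordProd (ω.eraseIdx k) := by
  classical
  obtain ⟨ω', hω', h'⟩ := cs.exists_isReduced (cs.wordProd ω * cs.simple i)
  have hprod : cs.wordProd (ω'.concat i) = cs.wordProd ω := by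
    rw [wordProd_concat, ← h']
    simp
  have hred : cs.IsReduced (ω'.concat i) := by
    rw [IsReduced, hprod, List.length_concat, ← hω'.eq, ← h', cs.isRightDescent_iff.1 hi]
  have hcount : (cs.rightInvSeq (ω'.concat i)).count (cs.simple i) = 1 :=
    List.count_eq_one_of_mem hred.nodup_rightInvSeq (by rw [rightInvSeq_concat]; simp)
  have hmem : cs.simple i ∈ cs.rightInvSeq ω := by
    by_contra hn
    have := cs.count_rightInvSeq_of_wordProd_eq hM hprod (cs.simple i)
    rw [hcount, List.count_eq_zero_of_not_mem hn] at this
    simp at this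
  obtain ⟨k, hk, hk'⟩ := List.mem_iff_getElem.1 hmem
  refine ⟨k, by simpa using hk, ?_⟩
  rw [← hk', ← List.getD_eq_getElem _ 1 hk, wordProd_mul_getD_rightInvSeq]

/-- The exchange condition, on the left. -/
theorem exists_wordProd_eraseIdx_of_isLeftDescent
    (hM : ∀ i j : I, i ≠ j → M i j = 2 ∨ M i j = 3) (ω : List I) {i : I}
    (hi : cs.IsLeftDescent (cs.wordProd ω) i) :
    ∃ k < ω.length, cs.simple i * cs.wordProd ω = cs.wordProd (ω.eraseIdx k) := by
  rw [← isRightDescent_inv_iff, ← wordProd_reverse] at hi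
  obtain ⟨k, hk, h⟩ := cs.exists_wordProd_eraseIdx_of_isRightDescent hM _ hi
  rw [List.length_reverse] at hk
  refine ⟨ω.length - 1 - k, by omega, ?_⟩
  rw [← inv_inj, ← wordProd_reverse (ω := ω.eraseIdx _), mul_inv_rev, inv_simple,
    ← wordProd_reverse, h]
  congr 1
  simp only [List.eraseIdx_eq_take_drop_succ, List.reverse_append, List.take_reverse,
    List.drop_reverse]
  congr 3 <;> omega

/-- Matsumoto's theorem for simply laced Coxeter systems: two reduced words of the same element are
connected by braid moves. -/
theorem rel_of_isReduced_of_wordProd_eq (hM : ∀ i j : I, i ≠ j → M i j = 2 ∨ M i j = 3)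
    {R : List I → List I → Prop} (refl : ∀ l, R l l)
    (trans : ∀ {l₁ l₂ l₃}, R l₁ l₂ → R l₂ l₃ → R l₁ l₃)
    (cons : ∀ i {l l'}, R l l' → R (i :: l) (i :: l'))
    (comm : ∀ i j l, M i j = 2 → R (i :: j :: l) (j :: i :: l))
    (braid : ∀ i j l, M i j = 3 → R (i :: j :: i :: l) (j :: i :: j :: l))
    {l l' : List I} (hl : cs.IsReduced l) (hl' : cs.IsReduced l')
    (h : cs.wordProd l = cs.wordProd l') : R l l' := by
  have tail {i : I} {l : List I} (h : cs.IsReduced (i :: l)) : cs.IsReduced l := h.drop 1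
  induction hn : l.length generalizing l l' with
  | zero =>
    have hlen : l'.length = 0 := by rw [← hl'.eq, ← h, hl.eq, hn]
    rw [List.length_eq_zero_iff] at hn hlen
    rw [hn, hlen]
    exact refl _
  | succ n ih =>
    have hlen : l'.length = n + 1 := by rw [← hl'.eq, ← h, hl.eq, hn]
    obtain ⟨i, m, rfl⟩ := List.exists_cons_of_length_eq_add_one hn
    obtain ⟨j, m', rfl⟩ := List.exists_cons_of_length_eq_add_one hlen
    have same_head {i : I} {l l' : List I} (hl : cs.IsReduced (i :: l))
        (hl' : cs.IsReduced (i :: l')) (h : cs.wordProd (i :: l) = cs.wordProd (i :: l'))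
        (hn : (i :: l).length = n + 1) : R (i :: l) (i :: l') :=
      cons i (ih (tail hl) (tail hl') (by simpa [wordProd_cons] using h) (by simpa using hn))
    by_cases hij : i = j
    · subst hij
      exact same_head hl hl' h hn
    have hne := cs.simple_ne_simple hM hij
    have hpow := cs.simple_mul_simple_pow i j
    have reduced {p : List I} (hp : cs.wordProd p = cs.wordProd (i :: m))
        (hpn : p.length = n + 1) : cs.IsReduced p := by
      rw [IsReduced, hp, hl.eq, hn, hpn]
    have connect {p q : List I} (hpq : cs.wordProd (i :: p) = cs.wordProd (j :: q))
        (hp : cs.wordProd (i :: p) = cs.wordProd (i :: m)) (hpn : (i :: p).length = n + 1)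
        (hqn : (j :: q).length = n + 1) (hR : R (i :: p) (j :: q)) : R (i :: m) (j :: m') :=
      trans (same_head hl (reduced hp hpn) hp.symm hn) <| trans hR <|
        same_head (reduced (hpq.symm.trans hp) hqn) hl' (hpq.symm.trans (hp.trans h)) hqn
    have hj : cs.IsLeftDescent (cs.wordProd (i :: m)) j := by
      rw [IsLeftDescent, hl.eq, hn, h, wordProd_cons, simple_mul_simple_cancel_left,
        (tail hl').eq]
      simp at hlen
      omega
    have hi : cs.IsLeftDescent (cs.wordProd (i :: m)) i := by
      rw [IsLeftDescent, hl.eq, wordProd_cons, simple_mul_simple_cancel_left, (tail hl).eq]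
      simp
    obtain ⟨k, hk, hkj⟩ := cs.exists_wordProd_eraseIdx_of_isLeftDescent hM _ hj
    rcases k with _ | k
    · rw [wordProd_cons, List.eraseIdx_cons_zero, ← mul_assoc, mul_eq_right,
        mul_eq_one_iff_eq_inv, inv_simple] at hkj
      exact absurd hkj.symm hne
    rw [List.eraseIdx_cons_succ] at hkj
    have hk' : k < m.length := by simpa using hk
    have hlen₁ := List.length_eraseIdx_add_one hk'
    simp only [List.length_cons, add_left_inj] at hn hlen
    generalize m.eraseIdx k = p at hkj hlen₁
    have hp : cs.wordProd (j :: i :: p) = cs.wordProd (i :: m) := by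
      rw [wordProd_cons, ← hkj, simple_mul_simple_cancel_left]
    rcases hM i j hij with hm | hm
    · rw [hm, pow_two, mul_eq_one_iff_eq_inv, mul_inv_rev, inv_simple, inv_simple] at hpow
      have hc : cs.wordProd (i :: j :: p) = cs.wordProd (j :: i :: p) := by
        simp only [wordProd_cons, ← mul_assoc, hpow]
      exact connect hc (hc.trans hp) (by simp; omega) (by simp; omega) (comm i j p hm)
    · have hbr := cs.simple_mul_simple_mul_simple hm
      rw [← hp] at hi
      obtain ⟨k, hk, hki⟩ := cs.exists_wordProd_eraseIdx_of_isLeftDescent hM _ hi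
      rcases k with _ | _ | k
      · simp only [wordProd_cons, List.eraseIdx_cons_zero, mul_right_inj] at hki
        have h₁ := cs.length_wordProd_le p
        rw [← hki, ← wordProd_cons, ← wordProd_cons, hp, hl.eq, List.length_cons] at h₁
        omega
      · simp only [wordProd_cons, List.eraseIdx_cons_succ, List.eraseIdx_cons_zero] at hki
        rw [← mul_assoc, ← mul_assoc, hbr, mul_assoc, mul_assoc, mul_right_inj, ← mul_assoc,
          mul_eq_right, mul_eq_one_iff_eq_inv, inv_simple] at hki
        exact absurd hki hne
      · simp only [List.eraseIdx_cons_succ] at hki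
        have hk' : k < p.length := by simpa using hk
        have hlen₂ := List.length_eraseIdx_add_one hk'
        generalize p.eraseIdx k = q at hki hlen₂
        have hq : cs.wordProd (i :: j :: i :: q) = cs.wordProd (i :: m) := by
          rw [wordProd_cons, ← hki, simple_mul_simple_cancel_left, hp]
        have hc : cs.wordProd (i :: j :: i :: q) = cs.wordProd (j :: i :: j :: q) := by
          simp only [wordProd_cons, ← mul_assoc, hbr]
        exact connect hc hq (by simp; omega) (by simp; omega) (braid i j q hm)

end CoxeterSystem

section UK

variable {I W : Type*} [Group W] {M : CoxeterMatrix I} {K : AddSubgroup ℝ}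

theorem kmin_of_le {a b : K} (h : (a : ℝ) ≤ b) : kmin a b = a := if_pos h

theorem kmin_of_ge {a b : K} (h : (b : ℝ) ≤ a) : kmin a b = b := by
  rw [kmin]
  split_ifs with h'
  · exact Subtype.ext (le_antisymm h' h)
  · rfl

theorem coe_kmin (a b : K) : ((kmin a b : K) : ℝ) = min (a : ℝ) b := by
  rcases le_total (a : ℝ) b with h | h
  · rw [kmin_of_le h, min_eq_left h]
  · rw [kmin_of_ge h, min_eq_right h]

theorem genU_mul_comm {i j : I} (h : M i j = 2) (a b : K) :
    genU M K i a * genU M K j b = genU M K j b * genU M K i a :=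
  (Con.eq _).2 (ConGen.Rel.of _ _ (UKRel.comm i j h a b))

theorem genU_braid {i j : I} (h : M i j = 3) (a b c : K) :
    genU M K i a * genU M K j b * genU M K i c =
      genU M K j (b + c - kmin a c) * genU M K i (kmin a c) * genU M K j (a + b - kmin a c) :=
  (Con.eq _).2 (ConGen.Rel.of _ _ (UKRel.braid i j h a b c))

theorem genU_mul_genU (i : I) (a b : K) :
    genU M K i a * genU M K i b = genU M K i (kmin a b) :=
  (Con.eq _).2 (ConGen.Rel.of _ _ (UKRel.idem i a b))

theorem genU_zero_mul_genU (i : I) {a : K} (ha : 0 ≤ (a : ℝ)) :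
    genU M K i 0 * genU M K i a = genU M K i 0 := by
  rw [genU_mul_genU, kmin_of_le (by simpa using ha)]

theorem prodU_cons (p : I × K) (ω : List (I × K)) :
    prodU M K (p :: ω) = genU M K p.1 p.2 * prodU M K ω := by
  simp [prodU]

theorem prodU_append (ω ω' : List (I × K)) :
    prodU M K (ω ++ ω') = prodU M K ω * prodU M K ω' := by
  simp [prodU]

theorem isRedWord_iff {cs : CoxeterSystem M W} {w : W} {l : List I} :
    IsRedWord cs w l ↔ cs.IsReduced l ∧ cs.wordProd l = w := by
  constructor
  · rintro ⟨rfl, h⟩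
    exact ⟨h.symm, rfl⟩
  · rintro ⟨h, rfl⟩
    exact ⟨rfl, h.symm⟩

/-- A product over a reduced word can be rewritten over any other reduced word of the same element,
keeping the exponents in a set stable under the braid relation. -/
theorem exists_prodU_eq_of_isRedWord (cs : CoxeterSystem M W)
    (hM : ∀ i j : I, i ≠ j → M i j = 2 ∨ M i j = 3) {S : K → Prop}
    (hS : ∀ a b c, S a → S b → S c →
      S (b + c - kmin a c) ∧ S (kmin a c) ∧ S (a + b - kmin a c))
    {w : W} {l : List I} (hl : IsRedWord cs w l) {ω : List (I × K)}
    (hω : IsRedWord cs w (ω.map Prod.fst)) (hωS : ∀ p ∈ ω, S p.2) :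
    ∃ ω' : List (I × K), ω'.map Prod.fst = l ∧ (∀ p ∈ ω', S p.2) ∧
      prodU M K ω = prodU M K ω' := by
  rw [isRedWord_iff] at hl hω
  revert ω
  suffices H : ∀ l' : List I, cs.IsReduced l' → cs.wordProd l' = w →
      ∀ ω : List (I × K), ω.map Prod.fst = l' → (∀ p ∈ ω, S p.2) →
        ∃ ω' : List (I × K), ω'.map Prod.fst = l ∧ (∀ p ∈ ω', S p.2) ∧
          prodU M K ω = prodU M K ω' from
    fun {ω} hω hωS => H _ hω.1 hω.2 ω rfl hωS
  intro l' hl' hw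
  refine cs.rel_of_isReduced_of_wordProd_eq hM
    (R := fun l' l => ∀ ω : List (I × K), ω.map Prod.fst = l' → (∀ p ∈ ω, S p.2) →
        ∃ ω' : List (I × K), ω'.map Prod.fst = l ∧ (∀ p ∈ ω', S p.2) ∧
          prodU M K ω = prodU M K ω') ?_ ?_ ?_ ?_ ?_ hl' hl.1 (hw.trans hl.2.symm)
  · exact fun l ω h hω => ⟨ω, h, hω, rfl⟩
  · intro l₁ l₂ l₃ h₁ h₂ ω h hω
    obtain ⟨ω₁, h', hω₁, e₁⟩ := h₁ ω h hω
    obtain ⟨ω₂, h'', hω₂, e₂⟩ := h₂ ω₁ h' hω₁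
    exact ⟨ω₂, h'', hω₂, e₁.trans e₂⟩
  · intro i l l' h ω hω hS'
    obtain ⟨⟨i, a⟩, ω, rfl, rfl, rfl⟩ := List.map_eq_cons_iff.1 hω
    simp only [List.forall_mem_cons] at hS'
    obtain ⟨ω', h', hω', e⟩ := h ω rfl hS'.2
    exact ⟨(i, a) :: ω', by simp [h'], List.forall_mem_cons.2 ⟨hS'.1, hω'⟩, by rw [prodU_cons, prodU_cons, e]⟩
  · intro i j l hij ω hω hS'
    obtain ⟨⟨i, a⟩, ω, rfl, rfl, h₁⟩ := List.map_eq_cons_iff.1 hω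
    obtain ⟨⟨j, b⟩, ω, rfl, rfl, rfl⟩ := List.map_eq_cons_iff.1 h₁
    simp only [List.forall_mem_cons] at hS'
    refine ⟨(j, b) :: (i, a) :: ω, rfl, ?_, ?_⟩
    · simp only [List.forall_mem_cons]
      exact ⟨hS'.2.1, hS'.1, hS'.2.2⟩
    · simp only [prodU_cons, ← mul_assoc]
      rw [genU_mul_comm hij]
  · intro i j l hij ω hω hS'
    obtain ⟨⟨i, a⟩, ω, rfl, rfl, h₁⟩ := List.map_eq_cons_iff.1 hω
    obtain ⟨⟨j, b⟩, ω, rfl, rfl, h₂⟩ := List.map_eq_cons_iff.1 h₁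
    obtain ⟨⟨i', c⟩, ω, rfl, hi, rfl⟩ := List.map_eq_cons_iff.1 h₂
    obtain rfl : i' = i := hi
    simp only [List.forall_mem_cons] at hS'
    obtain ⟨h₁, h₂, h₃⟩ := hS a b c hS'.1 hS'.2.1 hS'.2.2.1
    refine ⟨(j, b + c - kmin a c) :: (i', kmin a c) :: (j, a + b - kmin a c) :: ω, rfl, ?_, ?_⟩
    · simp only [List.forall_mem_cons]
      exact ⟨h₁, h₂, h₃, hS'.2.2.2⟩
    · simp only [prodU_cons, ← mul_assoc]
      rw [genU_braid hij]

theorem exists_nonneg_prodU_eq_of_isRedWord (cs : CoxeterSystem M W)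
    (hM : ∀ i j : I, i ≠ j → M i j = 2 ∨ M i j = 3)
    {w : W} {l : List I} (hl : IsRedWord cs w l) {ω : List (I × K)}
    (hω : IsRedWord cs w (ω.map Prod.fst)) (hω₀ : ∀ p ∈ ω, 0 ≤ (p.2 : ℝ)) :
    ∃ ω' : List (I × K), ω'.map Prod.fst = l ∧ (∀ p ∈ ω', 0 ≤ (p.2 : ℝ)) ∧
      prodU M K ω = prodU M K ω' := by
  refine exists_prodU_eq_of_isRedWord cs hM (S := fun a => 0 ≤ (a : ℝ)) ?_ hl hω hω₀
  intro a b c ha hb hc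
  have h₁ := min_le_left (a : ℝ) c
  have h₂ := min_le_right (a : ℝ) c
  push_cast [coe_kmin]
  exact ⟨by linarith, le_min ha hc, by linarith⟩

theorem prodU_zero_eq_of_isRedWord (cs : CoxeterSystem M W)
    (hM : ∀ i j : I, i ≠ j → M i j = 2 ∨ M i j = 3)
    {w : W} {l l' : List I} (hl : IsRedWord cs w l) (hl' : IsRedWord cs w l') :
    prodU M K (l.map fun i => (i, 0)) = prodU M K (l'.map fun i => (i, 0)) := by
  have hmap (l : List I) : (l.map fun i => (i, (0 : K))).map Prod.fst = l := by
    simp [Function.comp_def]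
  obtain ⟨ω', rfl, hω', e⟩ := exists_prodU_eq_of_isRedWord cs hM (S := fun a : K => a = 0)
    (by rintro _ _ _ rfl rfl rfl; simp [kmin]) hl' ((hmap l).symm ▸ hl) (by simp)
  rw [e, List.map_map]
  congr 1
  conv_lhs => rw [← List.map_id ω']
  exact List.map_congr_left fun p hp => Prod.ext rfl (hω' p hp)

variable {cs : CoxeterSystem M W} {w : W}

theorem exists_isRedWord_cons (hw : ∀ u : W, cs.length u ≤ cs.length w) (i : I) :
    ∃ l, IsRedWord cs w (i :: l) := by
  have hi := (cs.length_simple_mul w i).resolve_left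
    fun h => by have := hw (cs.simple i * w); omega
  obtain ⟨l, hl, h⟩ := cs.exists_isReduced (cs.simple i * w)
  refine ⟨l, by rw [cs.wordProd_cons, ← h, cs.simple_mul_simple_cancel_left], ?_⟩
  rw [List.length_cons, ← hl.eq, ← h, hi]

theorem IsRedWord.reverse {l : List I} (hl : IsRedWord cs w l) : IsRedWord cs w⁻¹ l.reverse := by
  obtain ⟨rfl, h⟩ := hl
  exact ⟨cs.wordProd_reverse l, by rw [List.length_reverse, cs.length_inv, h]⟩

theorem exists_isRedWord_concat (hw : ∀ u : W, cs.length u ≤ cs.length w) (i : I) :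
    ∃ l, IsRedWord cs w (l ++ [i]) := by
  obtain ⟨l, hl⟩ := exists_isRedWord_cons (cs := cs) (w := w⁻¹)
    (fun u => (hw u).trans (cs.length_inv w).ge) i
  exact ⟨l.reverse, by simpa using hl.reverse⟩

/-- Over a longest element, the product with zero exponents absorbs nonnegative products on the
right. -/
theorem prodU_zero_mul_prodU (hM : ∀ i j : I, i ≠ j → M i j = 2 ∨ M i j = 3)
    (hw : ∀ u : W, cs.length u ≤ cs.length w) {l : List I} (hl : IsRedWord cs w l)
    {ω : List (I × K)} (hω : ∀ p ∈ ω, 0 ≤ (p.2 : ℝ)) :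
    prodU M K (l.map fun i => (i, 0)) * prodU M K ω = prodU M K (l.map fun i => (i, 0)) := by
  induction ω with
  | nil => simp [prodU]
  | cons p ω ih =>
    simp only [List.forall_mem_cons] at hω
    obtain ⟨l', hl'⟩ := exists_isRedWord_concat hw p.1
    rw [prodU_cons, ← mul_assoc]
    convert ih hω.2 using 2
    rw [prodU_zero_eq_of_isRedWord cs hM hl hl', List.map_append, prodU_append, mul_assoc]
    congr 1
    simpa [prodU] using genU_zero_mul_genU p.1 hω.1

/-- Over a longest element, the product with zero exponents absorbs products with zero exponents on
the left. -/
theorem prodU_zero_mul_prodU_zero (hM : ∀ i j : I, i ≠ j → M i j = 2 ∨ M i j = 3)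
    (hw : ∀ u : W, cs.length u ≤ cs.length w) {l : List I} (hl : IsRedWord cs w l) (m : List I) :
    prodU M K (m.map fun i => (i, 0)) * prodU M K (l.map fun i => (i, 0)) =
      prodU M K (l.map fun i => (i, 0)) := by
  induction m with
  | nil => simp [prodU]
  | cons i m ih =>
    obtain ⟨l', hl'⟩ := exists_isRedWord_cons hw i
    rw [List.map_cons, prodU_cons, mul_assoc, ih, prodU_zero_eq_of_isRedWord cs hM hl hl',
      List.map_cons, prodU_cons, ← mul_assoc, genU_zero_mul_genU i (by simp)]

/-- On `𝒰(K₊)`, replacing the exponent of a leading `i` by zero is left multiplication by `i^0`. -/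
theorem exists_eq_genU_mul_of_mem_calUplus (hM : ∀ i j : I, i ≠ j → M i j = 2 ∨ M i j = 3)
    (hw : ∀ u : W, cs.length u ≤ cs.length w) {H : UK M K} (hH : H ∈ calUplus M K cs w) (i : I) :
    ∃ c : K, 0 ≤ (c : ℝ) ∧ ∃ ω : List (I × K), (∀ p ∈ ω, 0 ≤ (p.2 : ℝ)) ∧
      IsRedWord cs w (i :: ω.map Prod.fst) ∧ H = genU M K i c * prodU M K ω ∧
      genU M K i 0 * H = genU M K i 0 * prodU M K ω := by
  obtain ⟨ω, hω, hω₀, rfl⟩ := hH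
  obtain ⟨l, hl⟩ := exists_isRedWord_cons hw i
  obtain ⟨ω', h, hω', e⟩ := exists_nonneg_prodU_eq_of_isRedWord cs hM hl hω hω₀
  obtain ⟨⟨i, c⟩, ω', rfl, rfl, rfl⟩ := List.map_eq_cons_iff.1 h
  simp only [List.forall_mem_cons] at hω'
  rw [prodU_cons] at e
  exact ⟨c, hω'.1, ω', hω'.2, hl, e, by rw [e, ← mul_assoc, genU_zero_mul_genU _ hω'.1]⟩

theorem prodU_zero_mul_mem_calUplus (hM : ∀ i j : I, i ≠ j → M i j = 2 ∨ M i j = 3)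
    (hw : ∀ u : W, cs.length u ≤ cs.length w) {H : UK M K} (hH : H ∈ calUplus M K cs w)
    (m : List I) : prodU M K (m.map fun i => (i, 0)) * H ∈ calUplus M K cs w := by
  induction m with
  | nil => simpa [prodU] using hH
  | cons i m ih =>
    obtain ⟨c, -, ω, hω, hr, -, h⟩ := exists_eq_genU_mul_of_mem_calUplus hM hw ih i
    rw [List.map_cons, prodU_cons, mul_assoc, h]
    refine ⟨(i, 0) :: ω, by simpa using hr, ?_, (prodU_cons (i, 0) ω).symm⟩
    exact List.forall_mem_cons.2 ⟨le_rfl, hω⟩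

end UK

/-- **Theorem 13** (Lusztig, "Half circles on flag manifolds over a semifield").
For every reduced word `(i₁, …, i_ν)` of `w₀` and every `H ∈ 𝒰(K₊)` there is a descent
chain for `H` along `(i₁, …, i_ν)` ending at `𝐇 = i₁^0 i₂^0 ⋯ i_ν^0`; equivalently,
`H = T_{i₁}(c₁) T_{i₂}(c₂) ⋯ T_{i_ν}(c_ν) 𝐇` for the tuple `(c₁, …, c_ν) ∈ K₊^ν`. -/
theorem exists_descentChain
    {I W : Type*} [Finite I] [Nonempty I] [Group W] [Finite W]
    (M : CoxeterMatrix I) (hM : ∀ i j : I, i ≠ j → M i j = 2 ∨ M i j = 3)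
    (cs : CoxeterSystem M W)
    (K : AddSubgroup ℝ) (hK : K ≠ ⊥)
    (ν : ℕ) (w₀ : W) (hw₀ : cs.length w₀ = ν) (hν : ∀ w : W, cs.length w ≤ ν)
    (l : List I) (hl : IsRedWord cs w₀ l)
    (H : UK M K) (hH : H ∈ calUplus M K cs w₀) :
    ∃ (Hs : ℕ → UK M K) (c : ℕ → K),
      DescentChain M K cs w₀ l H Hs c ∧
      Hs l.length = prodU M K (l.map fun i => (i, 0)) := by
  have hw : ∀ u : W, cs.length u ≤ cs.length w₀ := fun u => hw₀ ▸ hν u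
  have hmem (k : ℕ) := prodU_zero_mul_mem_calUplus hM hw hH (l.take k).reverse
  have step (k : ℕ) : ∃ c : K, 0 ≤ (c : ℝ) ∧ ∀ hk : k < l.length, ∃ ω : List (I × K),
      (∀ p ∈ ω, 0 ≤ (p.2 : ℝ)) ∧
      IsRedWord cs w₀ (l.get ⟨k, hk⟩ :: ω.map Prod.fst) ∧
      prodU M K ((l.take k).reverse.map fun i => (i, 0)) * H =
        genU M K (l.get ⟨k, hk⟩) c * prodU M K ω ∧
      prodU M K ((l.take (k + 1)).reverse.map fun i => (i, 0)) * H =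
        genU M K (l.get ⟨k, hk⟩) 0 * prodU M K ω := by
    by_cases hk : k < l.length
    · obtain ⟨c, hc, ω, hω, hr, h₁, h₂⟩ :=
        exists_eq_genU_mul_of_mem_calUplus hM hw (hmem k) (l.get ⟨k, hk⟩)
      refine ⟨c, hc, fun _ => ⟨ω, hω, hr, h₁, ?_⟩⟩
      rw [← h₂, List.take_succ_eq_append_getElem hk, List.reverse_append, List.reverse_singleton,
        List.singleton_append, List.map_cons, prodU_cons, mul_assoc]
      rfl
    · exact ⟨0, by simp, fun h => absurd h hk⟩
  choose c hc hstep using step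
  refine ⟨fun k => prodU M K ((l.take k).reverse.map fun i => (i, 0)) * H, c,
    ⟨by simp [prodU], fun k _ => hmem k, fun k _ => hc k, hstep⟩, ?_⟩
  have hw' : ∀ u : W, cs.length u ≤ cs.length w₀⁻¹ :=
    fun u => (hw u).trans (cs.length_inv w₀).ge
  obtain ⟨ω, -, hω, rfl⟩ := hH
  simp only [List.take_length]
  rw [prodU_zero_mul_prodU hM hw' hl.reverse hω,
    ← prodU_zero_mul_prodU hM hw' hl.reverse (ω := l.map fun i => (i, 0)) (by simp),
    prodU_zero_mul_prodU_zero hM hw hl]
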